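/- Let n ≥ 1, R > 0, k ≥ 1 an integer, β, γ ∈ ℝ, 1 < p < ∞, b > 1, a + (k-1)p < n, 0 < c ≤ (n-a-(k-1)p)/(b+(k-1)p-1), 1 < q < ∞, 0 < r < ∞ with p + q ≥ r, and δ ∈ [0,1] ∩ [(r-q)/r, p/r]. Assume δr/p + (1-δ)r/q = 1 and γ = -δ + β(1-δ). Define ω(x) = |x|^{(a+(k-1)p)/p} · (1-(|x|/R)^c)^{(b+(k-1)p)/p}, and for s > 0 and a weight w write ‖w f‖_{L^s(B(0,R))} = (∫_{B(0,R)} w(x)^s |f(x)|^s dx)^{1/s}. Then for every complex-valued function f ∈ C_0^k(B(0,R)\{0}) one has ∏_{j=0}^{k-1} ((b+jp-1)c/p)^δ · ‖ω^γ f‖_{L^r(B(0,R))} ≤ (∫_{B(0,R)} |𝓡^k f(x)|^p / (|x|^{a-p} (1-(|x|/R)^c)^{b-p}) dx)^{δ/p} · ‖ω^β f‖_{L^q(B(0,R))}^{1-δ}. -/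

import Mathlib

open MeasureTheory Metric

/-- The radial derivative `𝓡f(x) = Df(x)[x/|x|]` of a complex-valued function on `ℝⁿ`. -/
noncomputable def radDeriv {n : ℕ} (f : EuclideanSpace ℝ (Fin n) → ℂ)
    (x : EuclideanSpace ℝ (Fin n)) : ℂ :=
  fderiv ℝ f x (‖x‖⁻¹ • x)

section HardyWeight

variable {E : Type*} [NormedAddCommGroup E]

/-- The power weight `|x|^a (1 - (|x|/R)^c)^b`, singular at the origin and on the sphere of
radius `R`. -/
noncomputable def hardyWeight (R c a b : ℝ) (x : E) : ℝ :=
  ‖x‖ ^ a * (1 - (‖x‖ / R) ^ c) ^ b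

lemma one_sub_norm_div_rpow_pos {R c : ℝ} (hR : 0 < R) (hc : 0 < c) {x : E}
    (hx : x ∈ ball (0 : E) R \ {0}) : 0 < 1 - (‖x‖ / R) ^ c := by
  have h1 : ‖x‖ < R := by simpa using hx.1
  have := Real.rpow_lt_one (by positivity) ((div_lt_one hR).2 h1) hc
  linarith

lemma norm_pos_of_mem_puncturedBall {R : ℝ} {x : E} (hx : x ∈ ball (0 : E) R \ {0}) :
    0 < ‖x‖ :=
  norm_pos_iff.2 hx.2

lemma hardyWeight_pos {R c : ℝ} (hR : 0 < R) (hc : 0 < c) (a b : ℝ) {x : E}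
    (hx : x ∈ ball (0 : E) R \ {0}) : 0 < hardyWeight R c a b x :=
  mul_pos (Real.rpow_pos_of_pos (norm_pos_of_mem_puncturedBall hx) _)
    (Real.rpow_pos_of_pos (one_sub_norm_div_rpow_pos hR hc hx) _)

lemma hardyWeight_rpow {R c : ℝ} (hR : 0 < R) (hc : 0 < c) (a b s : ℝ) {x : E}
    (hx : x ∈ ball (0 : E) R \ {0}) :
    hardyWeight R c a b x ^ s = hardyWeight R c (a * s) (b * s) x := by
  have h1 := norm_pos_of_mem_puncturedBall hx
  have h2 := one_sub_norm_div_rpow_pos hR hc hx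
  rw [hardyWeight, Real.mul_rpow (by positivity) (by positivity), ← Real.rpow_mul h1.le,
    ← Real.rpow_mul h2.le, hardyWeight]

lemma hardyWeight_add {R c : ℝ} (hR : 0 < R) (hc : 0 < c) (a b a' b' : ℝ) {x : E}
    (hx : x ∈ ball (0 : E) R \ {0}) :
    hardyWeight R c (a + a') (b + b') x = hardyWeight R c a b x * hardyWeight R c a' b' x := by
  have h1 := norm_pos_of_mem_puncturedBall hx
  have h2 := one_sub_norm_div_rpow_pos hR hc hx
  simp only [hardyWeight, Real.rpow_add h1, Real.rpow_add h2]
  ring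

lemma hardyWeight_neg {R c : ℝ} (hR : 0 < R) (hc : 0 < c) (a b : ℝ) {x : E}
    (hx : x ∈ ball (0 : E) R \ {0}) :
    hardyWeight R c (-a) (-b) x = (hardyWeight R c a b x)⁻¹ := by
  rw [← Real.rpow_neg_one, hardyWeight_rpow hR hc _ _ _ hx, mul_neg_one, mul_neg_one]

variable [InnerProductSpace ℝ E]

lemma contDiffAt_hardyWeight {R c : ℝ} (hR : 0 < R) (hc : 0 < c) (a b : ℝ) {x : E}
    (hx : x ∈ ball (0 : E) R \ {0}) {m : WithTop ℕ∞} :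
    ContDiffAt ℝ m (hardyWeight R c a b) x := by
  have h1 := norm_pos_of_mem_puncturedBall hx
  have h2 := one_sub_norm_div_rpow_pos hR hc hx
  have hn : ContDiffAt ℝ m (fun y : E => ‖y‖) x := contDiffAt_norm ℝ hx.2
  refine (hn.rpow_const_of_ne h1.ne').mul (ContDiffAt.rpow_const_of_ne ?_ h2.ne')
  exact contDiffAt_const.sub ((hn.div_const R).rpow_const_of_ne (by positivity))

lemma continuousOn_hardyWeight {R c : ℝ} (hR : 0 < R) (hc : 0 < c) (a b : ℝ) :
    ContinuousOn (hardyWeight R c a b) (ball (0 : E) R \ {0}) := fun _ hx =>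
  (contDiffAt_hardyWeight (m := 0) hR hc a b hx).continuousAt.continuousWithinAt

lemma fderiv_hardyWeight_self {R c : ℝ} (hR : 0 < R) (hc : 0 < c) (a b : ℝ) {x : E}
    (hx : x ∈ ball (0 : E) R \ {0}) :
    fderiv ℝ (hardyWeight R c a b) x x =
      hardyWeight R c a (b - 1) x *
        (a * (1 - (‖x‖ / R) ^ c) - b * c * (‖x‖ / R) ^ c) := by
  have h1 := norm_pos_of_mem_puncturedBall hx
  have h2 := one_sub_norm_div_rpow_pos hR hc hx
  have hnd : DifferentiableAt ℝ (fun y : E => ‖y‖) x :=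
    (contDiffAt_norm (n := 1) ℝ hx.2).differentiableAt one_ne_zero
  have hψ : HasDerivAt (fun t : ℝ => t ^ a * (1 - (t / R) ^ c) ^ b)
      (a * ‖x‖ ^ (a - 1) * (1 - (‖x‖ / R) ^ c) ^ b +
        ‖x‖ ^ a * (-(1 / R * c * (‖x‖ / R) ^ (c - 1)) * b * (1 - (‖x‖ / R) ^ c) ^ (b - 1)))
      ‖x‖ := by
    have e1 : HasDerivAt (fun t : ℝ => t ^ a) (a * ‖x‖ ^ (a - 1)) ‖x‖ :=
      Real.hasDerivAt_rpow_const (Or.inl h1.ne')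
    have e2 : HasDerivAt (fun t : ℝ => (t / R) ^ c) (1 / R * c * (‖x‖ / R) ^ (c - 1)) ‖x‖ :=
      ((hasDerivAt_id ‖x‖).div_const R).rpow_const (Or.inl (div_pos h1 hR).ne')
    exact e1.mul ((e2.const_sub 1).rpow_const (Or.inl h2.ne'))
  have hcomp := hψ.comp_hasFDerivAt x hnd.hasFDerivAt
  have heq : fderiv ℝ (hardyWeight R c a b) x = _ := hcomp.fderiv
  rw [heq, smul_apply, hnd.fderiv_norm_self, hardyWeight, smul_eq_mul]
  have hu : 0 < ‖x‖ / R := by positivity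
  rw [Real.rpow_sub_one h1.ne', Real.rpow_sub_one hu.ne', Real.rpow_sub_one h2.ne']
  field_simp
  ring

end HardyWeight

lemma integral_fderiv_apply_self {n : ℕ} {h : EuclideanSpace ℝ (Fin n) → ℝ}
    (hh : ContDiff ℝ 1 h) (hcomp : HasCompactSupport h) :
    ∫ x, fderiv ℝ h x x = -(n * ∫ x, h x) := by
  let e := fun i : Fin n => EuclideanSpace.single i (1 : ℝ)
  have hfd : Continuous (fderiv ℝ h) := hh.continuous_fderiv one_ne_zero
  have hsum : ∀ x, fderiv ℝ h x x = ∑ i, x i * fderiv ℝ h x (e i) := fun x => by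
    conv_lhs =>
      arg 2
      rw [← (EuclideanSpace.basisFun (Fin n) ℝ).sum_repr x]
    simp only [map_sum, map_smul, EuclideanSpace.basisFun_repr, EuclideanSpace.basisFun_apply,
      smul_eq_mul, e]
  have hcoord : ∀ (i : Fin n) (x : EuclideanSpace ℝ (Fin n)),
      HasFDerivAt (fun y : EuclideanSpace ℝ (Fin n) => y i)
        (EuclideanSpace.proj i : EuclideanSpace ℝ (Fin n) →L[ℝ] ℝ) x :=
    fun i x => (EuclideanSpace.proj i : EuclideanSpace ℝ (Fin n) →L[ℝ] ℝ).hasFDerivAt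
  have hint : ∀ i, Integrable fun x => x i * fderiv ℝ h x (e i) := fun i =>
    Continuous.integrable_of_hasCompactSupport (by fun_prop)
      ((hcomp.fderiv_apply (𝕜 := ℝ) (e i)).mul_left)
  have hpart : ∀ i, ∫ x, x i * fderiv ℝ h x (e i) = -∫ x, h x := fun i => by
    rw [integral_mul_fderiv_eq_neg_fderiv_mul_of_integrable
      (f := fun y : EuclideanSpace ℝ (Fin n) => y i) (g := h) (v := e i) ?_ (hint i) ?_
      (fun x _ => (hcoord i x).differentiableAt)
      (fun x _ => hh.differentiable one_ne_zero x)]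
    · simp [(hcoord i _).fderiv, e]
    · simpa [(hcoord i _).fderiv, e] using hh.continuous.integrable_of_hasCompactSupport hcomp
    · exact Continuous.integrable_of_hasCompactSupport
        (by have := hh.continuous; fun_prop) hcomp.mul_left
  simp_rw [hsum]
  rw [integral_finsetSum _ fun i _ => hint i]
  simp [hpart]

section RadDeriv

variable {n : ℕ} {f : EuclideanSpace ℝ (Fin n) → ℂ}

lemma tsupport_radDeriv_subset : tsupport (radDeriv f) ⊆ tsupport f := by
  refine (closure_mono fun x hx => ?_).trans (tsupport_fderiv_subset ℝ (f := f))
  rw [Function.mem_support] at hx ⊢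
  exact fun h0 => hx (by simp [radDeriv, h0])

lemma ContDiff.radDeriv {k : ℕ} (hf : ContDiff ℝ (k + 1 : ℕ) f) (h0 : 0 ∉ tsupport f) :
    ContDiff ℝ k (radDeriv f) := by
  rw [contDiff_iff_contDiffAt]
  intro x
  by_cases hx : x ∈ tsupport (_root_.radDeriv f)
  · have hx0 : x ≠ 0 := fun h => h0 (h ▸ tsupport_radDeriv_subset hx)
    have h1 : ContDiff ℝ k (fderiv ℝ f) := hf.fderiv_right (by norm_cast)
    have h2 : ContDiffAt ℝ k (fun y : EuclideanSpace ℝ (Fin n) => ‖y‖⁻¹) x :=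
      (contDiffAt_norm ℝ hx0).inv (norm_ne_zero_iff.2 hx0)
    exact h1.contDiffAt.clm_apply (h2.smul contDiffAt_id)
  · exact contDiffAt_const.congr_of_eventuallyEq (notMem_tsupport_iff_eventuallyEq.1 hx)

lemma norm_fderiv_apply_self {x : EuclideanSpace ℝ (Fin n)} (hx : x ≠ 0) :
    ‖fderiv ℝ f x x‖ = ‖x‖ * ‖radDeriv f x‖ := by
  have := norm_ne_zero_iff.2 hx
  rw [radDeriv, map_smul, norm_smul, norm_inv, norm_norm, mul_inv_cancel_left₀ this]

end RadDeriv

lemma integrable_mul_norm_rpow {n : ℕ} {F : Type*} [NormedAddCommGroup F]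
    {s : Set (EuclideanSpace ℝ (Fin n))} (hs : IsOpen s) {w : EuclideanSpace ℝ (Fin n) → ℝ}
    (hw : ContinuousOn w s) {g : EuclideanSpace ℝ (Fin n) → F} (hg : Continuous g)
    (hcomp : HasCompactSupport g) (hsupp : tsupport g ⊆ s) {r : ℝ} (hr : 0 < r) :
    Integrable fun x => w x * ‖g x‖ ^ r := by
  have hzero : Function.support (fun x => w x * ‖g x‖ ^ r) ⊆ Function.support g := by
    intro x hx hgx
    exact hx (by simp [hgx, Real.zero_rpow hr.ne'])
  refine Continuous.integrable_of_hasCompactSupport ?_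
    (hcomp.mono' (hzero.trans (subset_tsupport g)))
  refine ContinuousOn.continuous_of_tsupport_subset (hw.mul ?_) hs
    ((closure_mono hzero).trans hsupp)
  exact (hg.norm.rpow_const fun x => Or.inr hr.le).continuousOn

lemma mul_rpow_sub_one_mul_le {p s y : ℝ} (hp : 1 < p) (hs : 0 ≤ s) (hy : 0 ≤ y) :
    p * (s ^ (p - 1) * y) ≤ (p - 1) * s ^ p + y ^ p := by
  have hp0 : 0 < p := by linarith
  have hp1 : 0 < p - 1 := by linarith
  have h := Real.young_inequality_of_nonneg hy (Real.rpow_nonneg hs (p - 1))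
    (Real.HolderConjugate.conjExponent hp)
  rw [← Real.rpow_mul hs, Real.conjExponent, mul_div_cancel₀ _ hp1.ne'] at h
  have h2 := mul_le_mul_of_nonneg_left h hp0.le
  have e : p * (y ^ p / p + s ^ p / (p / (p - 1))) = (p - 1) * s ^ p + y ^ p := by
    field_simp
    ring
  linarith

lemma fderiv_norm_rpow_comp_apply_ge {E F : Type*} [NormedAddCommGroup E] [NormedSpace ℝ E]
    [NormedAddCommGroup F] [InnerProductSpace ℝ F] {f : E → F} {x : E}
    (hf : DifferentiableAt ℝ f x) {p : ℝ} (hp : 1 < p) (v : E) :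
    -(p * (‖f x‖ ^ (p - 1) * ‖fderiv ℝ f x v‖)) ≤ fderiv ℝ (fun y => ‖f y‖ ^ p) x v := by
  have h := (hasFDerivAt_norm_rpow (f x) hp).comp x hf.hasFDerivAt
  have heq : fderiv ℝ (fun y => ‖f y‖ ^ p) x = _ := h.fderiv
  rw [heq]
  simp only [ContinuousLinearMap.comp_apply, smul_apply, innerSL_apply_apply,
    smul_eq_mul]
  rcases eq_or_ne (f x) 0 with h0 | h0
  · simp [h0, Real.zero_rpow (sub_ne_zero.2 hp.ne')]
  have hpos := norm_pos_iff.2 h0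
  have h1 : ‖f x‖ ^ (p - 1) = ‖f x‖ ^ (p - 2) * ‖f x‖ := by
    rw [← Real.rpow_add_one hpos.ne']
    ring_nf
  have h2 := neg_le_of_abs_le (abs_real_inner_le_norm (f x) (fderiv ℝ f x v))
  have h3 : 0 ≤ p * ‖f x‖ ^ (p - 2) := by positivity
  rw [h1]
  nlinarith [mul_le_mul_of_nonneg_left h2 h3]

section Hardy

variable {n : ℕ} {R c p : ℝ} {f : EuclideanSpace ℝ (Fin n) → ℂ}

/-- The pointwise inequality behind the Hardy inequality: up to a divergence, the weighted
`p`-th power of `f` is controlled by that of its radial derivative. -/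
lemma hardy_pointwise (hR : 0 < R) (hp : 1 < p) (hc : 0 < c) {a b : ℝ} (hb : 1 < b)
    (hac : c * (b - 1) ≤ n - a) {x : EuclideanSpace ℝ (Fin n)}
    (hx : x ∈ ball (0 : EuclideanSpace ℝ (Fin n)) R \ {0}) (hf : DifferentiableAt ℝ f x) :
    ((b - 1) * c / p) ^ p * (hardyWeight R c (-a) (-b) x * ‖f x‖ ^ p) ≤
      hardyWeight R c (p - a) (p - b) x * ‖radDeriv f x‖ ^ p +
        ((b - 1) * c / p) ^ (p - 1) *
          (n * (hardyWeight R c (-a) (1 - b) x * ‖f x‖ ^ p) +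
            fderiv ℝ (fun y => hardyWeight R c (-a) (1 - b) y * ‖f y‖ ^ p) x x) := by
  have hp0 : 0 < p := by linarith
  have h1 := norm_pos_of_mem_puncturedBall hx
  have h2 := one_sub_norm_div_rpow_pos hR hc hx
  set v := 1 - (‖x‖ / R) ^ c with hv
  set W := hardyWeight R c (-a) (-b) x with hW
  set l := (b - 1) * c / p with hl
  have hWpos : 0 < W := hardyWeight_pos hR hc _ _ hx
  have hlpos : 0 < l := div_pos (mul_pos (by linarith) hc) hp0
  set A := ‖f x‖ with hA
  set D := ‖radDeriv f x‖ with hD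
  have hA0 : 0 ≤ A := norm_nonneg _
  have hD0 : 0 ≤ D := norm_nonneg _
  have hg : hardyWeight R c (-a) (1 - b) x = v * W := by
    have := hardyWeight_add hR hc 0 1 (-a) (-b) hx
    rw [zero_add, ← sub_eq_add_neg] at this
    rw [this, show hardyWeight R c 0 1 x = v by simp [hardyWeight, hv]]
  have hWt : hardyWeight R c (p - a) (p - b) x * D ^ p = W * (‖x‖ * v * D) ^ p := by
    rw [sub_eq_add_neg, sub_eq_add_neg, hardyWeight_add hR hc p p (-a) (-b) hx,
      Real.mul_rpow (by positivity) hD0, Real.mul_rpow h1.le h2.le, hardyWeight]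
    ring
  have hdg := fderiv_hardyWeight_self hR hc (-a) (1 - b) hx
  rw [show (1 - b - 1 : ℝ) = -b by ring, ← hW] at hdg
  have hgd : DifferentiableAt ℝ
      (hardyWeight R c (-a) (1 - b) : EuclideanSpace ℝ (Fin n) → ℝ) x :=
    (contDiffAt_hardyWeight (m := 1) hR hc _ _ hx).differentiableAt one_ne_zero
  have hfd : DifferentiableAt ℝ (fun y => ‖f y‖ ^ p) x :=
    ((hasFDerivAt_norm_rpow (f x) hp).comp x hf.hasFDerivAt).differentiableAt
  have hlow := fderiv_norm_rpow_comp_apply_ge hf hp x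
  rw [norm_fderiv_apply_self hx.2, ← hA, ← hD] at hlow
  have hprod : fderiv ℝ (fun y => hardyWeight R c (-a) (1 - b) y * ‖f y‖ ^ p) x x =
      v * W * fderiv ℝ (fun y => ‖f y‖ ^ p) x x +
        A ^ p * (W * (-a * v - (1 - b) * c * (1 - v))) := by
    rw [fderiv_fun_mul hgd hfd]
    simp only [add_apply, smul_apply, smul_eq_mul, hg, hdg]
    simp [hv, hA]
  rw [hprod, hg, hWt]
  have hyoung := mul_rpow_sub_one_mul_le hp (mul_nonneg hlpos.le hA0)
    (y := ‖x‖ * v * D) (by positivity)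
  rw [Real.mul_rpow hlpos.le hA0, Real.mul_rpow hlpos.le hA0] at hyoung
  have hlp : l ^ p = l ^ (p - 1) * l := by
    rw [← Real.rpow_add_one hlpos.ne']
    ring_nf
  have hL : 0 < l ^ (p - 1) := by positivity
  have hdiv : p * l ≤ n * v + (-a * v - (1 - b) * c * (1 - v)) := by
    have hpl : p * l = (b - 1) * c := by
      rw [hl]
      field_simp
    nlinarith [mul_le_mul_of_nonneg_right hac h2.le]
  have hAp : 0 ≤ A ^ p := by positivity
  have k1 : l ^ (p - 1) * (W * A ^ p) * (p * l) ≤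
      l ^ (p - 1) * (W * A ^ p) * (n * v + (-a * v - (1 - b) * c * (1 - v))) :=
    mul_le_mul_of_nonneg_left hdiv (by positivity)
  have k2 : l ^ (p - 1) * (v * W) * -(p * (A ^ (p - 1) * (‖x‖ * D))) ≤
      l ^ (p - 1) * (v * W) * fderiv ℝ (fun y => ‖f y‖ ^ p) x x :=
    mul_le_mul_of_nonneg_left hlow (by positivity)
  have k3 := mul_le_mul_of_nonneg_left hyoung hWpos.le
  rw [hlp] at k3 ⊢
  linarith

lemma isOpen_puncturedBall (R : ℝ) :
    IsOpen (ball (0 : EuclideanSpace ℝ (Fin n)) R \ {0}) :=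
  isOpen_ball.sdiff isClosed_singleton

lemma integrable_hardyWeight_mul (hR : 0 < R) (hc : 0 < c) (a b : ℝ) (hf : Continuous f)
    (hcomp : HasCompactSupport f)
    (hsupp : tsupport f ⊆ ball (0 : EuclideanSpace ℝ (Fin n)) R \ {0}) {r : ℝ} (hr : 0 < r) :
    Integrable fun x => hardyWeight R c a b x * ‖f x‖ ^ r :=
  integrable_mul_norm_rpow (isOpen_puncturedBall R) (continuousOn_hardyWeight hR hc a b) hf hcomp
    hsupp hr

/-- The first-order weighted Hardy inequality for the radial derivative. -/
lemma hardy_inequality (hR : 0 < R) (hp : 1 < p) (hc : 0 < c) {a b : ℝ} (hb : 1 < b)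
    (hac : c * (b - 1) ≤ n - a) (hf : ContDiff ℝ 1 f) (hcomp : HasCompactSupport f)
    (hsupp : tsupport f ⊆ ball (0 : EuclideanSpace ℝ (Fin n)) R \ {0}) :
    ((b - 1) * c / p) ^ p * ∫ x, hardyWeight R c (-a) (-b) x * ‖f x‖ ^ p ≤
      ∫ x, hardyWeight R c (p - a) (p - b) x * ‖radDeriv f x‖ ^ p := by
  have hp0 : 0 < p := by linarith
  let h := fun y => hardyWeight R c (-a) (1 - b) y * ‖f y‖ ^ p
  have hzero : ∀ x, f x = 0 → h x = 0 := fun x hx => by simp [h, hx, Real.zero_rpow hp0.ne']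
  have hhsupp : tsupport h ⊆ tsupport f := closure_mono fun x hx hfx => hx (hzero x hfx)
  have hhcomp : HasCompactSupport h := hcomp.mono' ((subset_tsupport h).trans hhsupp)
  have hh : ContDiff ℝ 1 h := by
    rw [contDiff_iff_contDiffAt]
    intro x
    by_cases hx : x ∈ tsupport h
    · exact (contDiffAt_hardyWeight hR hc _ _ (hsupp (hhsupp hx))).mul
        ((contDiff_norm_rpow hp).comp hf).contDiffAt
    · exact contDiffAt_const.congr_of_eventuallyEq (notMem_tsupport_iff_eventuallyEq.1 hx)
  have hrad : ContDiff ℝ (0 : ℕ) (radDeriv f) :=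
    ContDiff.radDeriv (by simpa using hf) fun h0 => (hsupp h0).2 rfl
  have hradcomp : HasCompactSupport (radDeriv f) :=
    hcomp.mono' ((subset_tsupport _).trans tsupport_radDeriv_subset)
  have i1 := integrable_hardyWeight_mul hR hc (-a) (-b) hf.continuous hcomp hsupp hp0
  have i2 := integrable_hardyWeight_mul hR hc (p - a) (p - b) hrad.continuous hradcomp
    (tsupport_radDeriv_subset.trans hsupp) hp0
  have i3 : Integrable h := hh.continuous.integrable_of_hasCompactSupport hhcomp
  have i4 : Integrable fun x => fderiv ℝ h x x := by
    have := hh.continuous_fderiv one_ne_zero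
    refine Continuous.integrable_of_hasCompactSupport (by fun_prop)
      ((hhcomp.fderiv (𝕜 := ℝ)).mono fun x hx h0 => hx ?_)
    simp [h0]
  have hdiv := integral_fderiv_apply_self hh hhcomp
  have i5 : Integrable fun x => n * h x + fderiv ℝ h x x := (i3.const_mul _).add i4
  have hmono := integral_mono (i1.const_mul (((b - 1) * c / p) ^ p))
    (i2.add (i5.const_mul (((b - 1) * c / p) ^ (p - 1)))) fun x => ?_
  · simp only [Pi.add_apply] at hmono
    rw [integral_const_mul, integral_add i2 (i5.const_mul _), integral_const_mul,
      integral_add (i3.const_mul _) i4, integral_const_mul, hdiv, add_neg_cancel, mul_zero,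
      add_zero] at hmono
    exact hmono
  · by_cases hx : x ∈ tsupport f
    · exact hardy_pointwise hR hp hc hb hac (hsupp hx) (hf.differentiable one_ne_zero x)
    · have e1 : f x = 0 := image_eq_zero_of_notMem_tsupport hx
      have e2 : radDeriv f x = 0 :=
        image_eq_zero_of_notMem_tsupport fun h' => hx (tsupport_radDeriv_subset h')
      have e3 : fderiv ℝ h x = 0 := image_eq_zero_of_notMem_tsupport fun h' =>
        hx (hhsupp (tsupport_fderiv_subset ℝ h'))
      simp [e1, e2, e3, hzero x e1, Real.zero_rpow hp0.ne']

/-- The weighted Hardy inequality of order `k` for the radial derivative. -/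
lemma hardy_inequality_iterate (hR : 0 < R) (hp : 1 < p) (hc : 0 < c) {a b : ℝ} (hb : 1 < b)
    (k : ℕ) (hac : c * (b + (k - 1) * p - 1) ≤ n - a - (k - 1) * p)
    (hf : ContDiff ℝ k f) (hcomp : HasCompactSupport f)
    (hsupp : tsupport f ⊆ ball (0 : EuclideanSpace ℝ (Fin n)) R \ {0}) :
    (∏ j ∈ Finset.range k, (b + j * p - 1) * c / p) ^ p *
        ∫ x, hardyWeight R c (-(a + (k - 1) * p)) (-(b + (k - 1) * p)) x * ‖f x‖ ^ p ≤
      ∫ x, hardyWeight R c (p - a) (p - b) x * ‖(radDeriv^[k] f) x‖ ^ p := by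
  have hp0 : 0 < p := by linarith
  induction k generalizing f with
  | zero => simp [← sub_eq_add_neg]
  | succ k ih =>
    have hkp : 0 ≤ k * p := by positivity
    push_cast at hac ⊢
    rw [add_sub_cancel_right] at hac ⊢
    have hstep := hardy_inequality hR hp hc (a := a + k * p) (b := b + k * p) (by linarith)
      (by linarith) (hf.of_le (by norm_cast; omega)) hcomp hsupp
    have hih := ih (f := radDeriv f) (by nlinarith [mul_pos hc hp0])
      (hf.radDeriv fun h0 => (hsupp h0).2 rfl)
      (hcomp.mono' ((subset_tsupport _).trans tsupport_radDeriv_subset))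
      (tsupport_radDeriv_subset.trans hsupp)
    have hnn : ∀ j : ℕ, 0 ≤ (b + j * p - 1) * c / p := fun j => by
      have : 0 ≤ (j : ℝ) * p := by positivity
      have : 0 ≤ b + j * p - 1 := by linarith
      positivity
    rw [Finset.prod_range_succ, Real.mul_rpow (Finset.prod_nonneg fun j _ => hnn j) (hnn k),
      mul_assoc, Function.iterate_succ_apply]
    refine (mul_le_mul_of_nonneg_left hstep
      (Real.rpow_nonneg (Finset.prod_nonneg fun j _ => hnn j) _)).trans ?_
    rwa [show p - (a + k * p) = -(a + (k - 1) * p) by ring,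
      show p - (b + k * p) = -(b + (k - 1) * p) by ring]

end Hardy

/-- Hölder's inequality in interpolation form. -/
lemma integral_rpow_mul_rpow_le {α : Type*} [MeasurableSpace α] {μ : Measure α} {F G : α → ℝ}
    (hF : Integrable F μ) (hG : Integrable G μ) (hF0 : 0 ≤ F) (hG0 : 0 ≤ G) {s t : ℝ}
    (hs : 0 ≤ s) (ht : 0 ≤ t) (hst : s + t = 1) :
    ∫ x, F x ^ s * G x ^ t ∂μ ≤ (∫ x, F x ∂μ) ^ s * (∫ x, G x ∂μ) ^ t := by
  have hIF : 0 ≤ ∫ x, F x ∂μ := integral_nonneg hF0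
  have hIG : 0 ≤ ∫ x, G x ∂μ := integral_nonneg hG0
  have hmeas : AEStronglyMeasurable (fun x => F x ^ s * G x ^ t) μ :=
    ((hF.aemeasurable.pow_const s).mul (hG.aemeasurable.pow_const t)).aestronglyMeasurable
  rw [integral_eq_lintegral_of_nonneg_ae (Filter.Eventually.of_forall fun x =>
    mul_nonneg (Real.rpow_nonneg (hF0 x) _) (Real.rpow_nonneg (hG0 x) _)) hmeas]
  refine ENNReal.toReal_le_of_le_ofReal (by positivity) ?_
  have h := ENNReal.lintegral_mul_norm_pow_le (μ := μ) hF.aemeasurable.ennreal_ofReal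
    hG.aemeasurable.ennreal_ofReal hs ht hst
  rw [← ofReal_integral_eq_lintegral_ofReal hF (Filter.Eventually.of_forall hF0),
    ← ofReal_integral_eq_lintegral_ofReal hG (Filter.Eventually.of_forall hG0),
    ENNReal.ofReal_rpow_of_nonneg hIF hs, ENNReal.ofReal_rpow_of_nonneg hIG ht,
    ← ENNReal.ofReal_mul (by positivity)] at h
  refine le_of_eq_of_le (lintegral_congr fun x => ?_) h
  rw [ENNReal.ofReal_mul (Real.rpow_nonneg (hF0 x) _), ENNReal.ofReal_rpow_of_nonneg (hF0 x) hs,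
    ENNReal.ofReal_rpow_of_nonneg (hG0 x) ht]

theorem unified_CKN_inequality {n : ℕ} (hn : 1 ≤ n) {R : ℝ} (hR : 0 < R)
    {k : ℕ} (hk : 1 ≤ k) {β γ p b a c q r δ : ℝ}
    (hp : 1 < p) (hb : 1 < b) (ha : a + ((k : ℝ) - 1) * p < (n : ℝ))
    (hc0 : 0 < c) (hc : c ≤ ((n : ℝ) - a - ((k : ℝ) - 1) * p) / (b + ((k : ℝ) - 1) * p - 1))
    (hq : 1 < q) (hr0 : 0 < r) (hpqr : r ≤ p + q)
    (hδ0 : 0 ≤ δ) (hδ1 : δ ≤ 1) (hδ2 : (r - q) / r ≤ δ) (hδ3 : δ ≤ p / r)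
    (hδpq : δ * r / p + (1 - δ) * r / q = 1) (hγ : γ = -δ + β * (1 - δ))
    (ω : EuclideanSpace ℝ (Fin n) → ℝ)
    (hω : ∀ x, ω x = ‖x‖ ^ ((a + ((k : ℝ) - 1) * p) / p) *
      (1 - (‖x‖ / R) ^ c) ^ ((b + ((k : ℝ) - 1) * p) / p))
    (f : EuclideanSpace ℝ (Fin n) → ℂ)
    (hf : ContDiff ℝ k f) (hcomp : HasCompactSupport f)
    (hsupp : tsupport f ⊆ ball (0 : EuclideanSpace ℝ (Fin n)) R \ {0}) :
    (∏ j ∈ Finset.range k, ((b + (j : ℝ) * p - 1) * c / p) ^ δ) *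
      (∫ x in ball (0 : EuclideanSpace ℝ (Fin n)) R,
        (ω x ^ γ) ^ r * ‖f x‖ ^ r) ^ (1 / r) ≤
    (∫ x in ball (0 : EuclideanSpace ℝ (Fin n)) R,
        ‖(radDeriv^[k] f) x‖ ^ p /
          (‖x‖ ^ (a - p) * (1 - (‖x‖ / R) ^ c) ^ (b - p))) ^ (δ / p) *
    ((∫ x in ball (0 : EuclideanSpace ℝ (Fin n)) R,
        (ω x ^ β) ^ q * ‖f x‖ ^ q) ^ (1 / q)) ^ (1 - δ) := by
  have hp0 : 0 < p := by linarith
  have hq0 : 0 < q := by linarith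
  have hk' : (0 : ℝ) ≤ k - 1 := by simpa using hk
  have hden : 0 < b + ((k : ℝ) - 1) * p - 1 := by nlinarith
  have hδ' : 0 ≤ 1 - δ := by linarith
  set s := (a + ((k : ℝ) - 1) * p) / p with hs
  set t := (b + ((k : ℝ) - 1) * p) / p with ht
  have hω' : ω = hardyWeight R c s t := funext hω
  have h0 : ∀ x ∉ ball (0 : EuclideanSpace ℝ (Fin n)) R, f x = 0 := fun x hx =>
    image_eq_zero_of_notMem_tsupport fun h => hx (hsupp h).1
  have hiter : ∀ m : ℕ, tsupport (radDeriv^[m] f) ⊆ tsupport f := fun m => by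
    induction m with
    | zero => exact subset_rfl
    | succ m ih =>
      rw [Function.iterate_succ_apply']
      exact tsupport_radDeriv_subset.trans ih
  have hA : ∫ x in ball (0 : EuclideanSpace ℝ (Fin n)) R,
        ‖(radDeriv^[k] f) x‖ ^ p / (‖x‖ ^ (a - p) * (1 - (‖x‖ / R) ^ c) ^ (b - p)) =
      ∫ x, hardyWeight R c (p - a) (p - b) x * ‖(radDeriv^[k] f) x‖ ^ p := by
    have hz : ∀ x ∉ tsupport f, (radDeriv^[k] f) x = 0 := fun x hx =>
      image_eq_zero_of_notMem_tsupport fun h => hx (hiter k h)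
    rw [setIntegral_eq_integral_of_forall_compl_eq_zero fun x hx => by
      simp [hz x fun h => hx (hsupp h).1, Real.zero_rpow hp0.ne']]
    refine integral_congr_ae (Filter.Eventually.of_forall fun x => ?_)
    by_cases hx : x ∈ tsupport f
    · have := hardyWeight_neg hR hc0 (a - p) (b - p) (hsupp hx)
      rw [neg_sub, neg_sub] at this
      beta_reduce
      rw [this, hardyWeight, div_eq_inv_mul]
    · simp [hz x hx, Real.zero_rpow hp0.ne']
  have hnorm : ∀ α ρ : ℝ, 0 < ρ → ∫ x in ball (0 : EuclideanSpace ℝ (Fin n)) R,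
      (ω x ^ α) ^ ρ * ‖f x‖ ^ ρ = ∫ x, hardyWeight R c (s * α * ρ) (t * α * ρ) x * ‖f x‖ ^ ρ := by
    intro α ρ hρ
    rw [setIntegral_eq_integral_of_forall_compl_eq_zero fun x hx => by
      simp [h0 x hx, Real.zero_rpow hρ.ne']]
    refine integral_congr_ae (Filter.Eventually.of_forall fun x => ?_)
    by_cases hx : x ∈ tsupport f
    · simp only [hω', hardyWeight_rpow hR hc0 _ _ _ (hsupp hx)]
    · simp [image_eq_zero_of_notMem_tsupport hx, Real.zero_rpow hρ.ne']
  have hhardy := hardy_inequality_iterate hR hp hc0 hb k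
    ((le_div_iff₀ hden).1 hc) hf hcomp hsupp
  have hs' : -(a + ((k : ℝ) - 1) * p) = s * -1 * p := by rw [hs]; field_simp
  have ht' : -(b + ((k : ℝ) - 1) * p) = t * -1 * p := by rw [ht]; field_simp
  rw [hs', ht'] at hhardy
  rw [hA, hnorm γ r hr0, hnorm β q hq0]
  have hlam : ∀ j ∈ Finset.range k, 0 ≤ (b + (j : ℝ) * p - 1) * c / p := fun j _ => by
    have : 0 ≤ (j : ℝ) * p := by positivity
    have : 0 ≤ b + j * p - 1 := by linarith
    positivity
  rw [Real.finsetProd_rpow _ _ hlam]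
  have hM := Finset.prod_nonneg hlam
  have hnn : ∀ α τ ρ : ℝ,
      0 < ρ →
      0 ≤ fun x : EuclideanSpace ℝ (Fin n) => hardyWeight R c α τ x * ‖f x‖ ^ ρ := by
    intro α τ ρ hρ x
    by_cases hx : x ∈ tsupport f
    · exact mul_nonneg (hardyWeight_pos hR hc0 _ _ (hsupp hx)).le (by positivity)
    · simp [image_eq_zero_of_notMem_tsupport hx, Real.zero_rpow hρ.ne']
  have hX0 := hnn (s * -1 * p) (t * -1 * p) p hp0
  have hY0 := hnn (s * β * q) (t * β * q) q hq0
  have hZ0 := hnn (s * γ * r) (t * γ * r) r hr0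
  have hholder := integral_rpow_mul_rpow_le
    (integrable_hardyWeight_mul hR hc0 (s * -1 * p) (t * -1 * p) hf.continuous hcomp hsupp hp0)
    (integrable_hardyWeight_mul hR hc0 (s * β * q) (t * β * q) hf.continuous hcomp hsupp hq0)
    hX0 hY0 (s := δ * r / p) (t := (1 - δ) * r / q) (by positivity) (by positivity) hδpq
  have hsplit : ∀ x, (hardyWeight R c (s * -1 * p) (t * -1 * p) x * ‖f x‖ ^ p) ^ (δ * r / p) *
      (hardyWeight R c (s * β * q) (t * β * q) x * ‖f x‖ ^ q) ^ ((1 - δ) * r / q) =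
      hardyWeight R c (s * γ * r) (t * γ * r) x * ‖f x‖ ^ r := by
    intro x
    by_cases hx : f x = 0
    · rw [hx, norm_zero, Real.zero_rpow hp0.ne', Real.zero_rpow hq0.ne', Real.zero_rpow hr0.ne',
        mul_zero, mul_zero, mul_zero, ← Real.rpow_add' le_rfl (by rw [hδpq]; exact one_ne_zero),
        hδpq, Real.rpow_one]
    · have hx' := hsupp (subset_tsupport f hx)
      have hfx := norm_pos_iff.2 hx
      rw [Real.mul_rpow (hardyWeight_pos hR hc0 _ _ hx').le (by positivity),
        Real.mul_rpow (hardyWeight_pos hR hc0 _ _ hx').le (by positivity),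
        hardyWeight_rpow hR hc0 _ _ _ hx', hardyWeight_rpow hR hc0 _ _ _ hx',
        ← Real.rpow_mul hfx.le, ← Real.rpow_mul hfx.le, mul_mul_mul_comm,
        ← hardyWeight_add hR hc0 _ _ _ _ hx', ← Real.rpow_add hfx, hγ]
      congr 2 <;> field_simp <;> ring
  simp_rw [hsplit] at hholder
  set X := ∫ x, hardyWeight R c (s * -1 * p) (t * -1 * p) x * ‖f x‖ ^ p
  set Y := ∫ x, hardyWeight R c (s * β * q) (t * β * q) x * ‖f x‖ ^ q
  set Z := ∫ x, hardyWeight R c (s * γ * r) (t * γ * r) x * ‖f x‖ ^ r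
  have hX : 0 ≤ X := integral_nonneg hX0
  have hY : 0 ≤ Y := integral_nonneg hY0
  have hZ : 0 ≤ Z := integral_nonneg hZ0
  set M := ∏ j ∈ Finset.range k, (b + (j : ℝ) * p - 1) * c / p
  calc M ^ δ * Z ^ (1 / r)
      ≤ M ^ δ * (X ^ (δ * r / p) * Y ^ ((1 - δ) * r / q)) ^ (1 / r) := by gcongr
    _ = (M ^ p * X) ^ (δ / p) * (Y ^ (1 / q)) ^ (1 - δ) := by
      rw [Real.mul_rpow (by positivity) (by positivity), Real.mul_rpow (by positivity) hX,
        ← Real.rpow_mul hX, ← Real.rpow_mul hY, ← Real.rpow_mul hY, ← Real.rpow_mul hM,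
        show δ * r / p * (1 / r) = δ / p by field_simp,
        show (1 - δ) * r / q * (1 / r) = 1 / q * (1 - δ) by field_simp,
        show p * (δ / p) = δ by field_simp, mul_assoc]
    _ ≤ _ := by gcongr
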